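/- arXiv:1204.5283 — 7 statements merged into one kernel-verified Lean document; each statement's English description precedes it below -/
import Mathlib

section
/- Let a,b,c,d ≥ 0 satisfy a+c = 1, b+d = 2, ac = (1-b)² (Class II) and a < 1. Then the entanglement witness W[a,b,c,d] on ℂ⁴ ⊗ ℂ⁴ is optimal: for every nonzero positive semidefinite operator P on ℂ⁴ ⊗ ℂ⁴ and every ε > 0, the operator W[a,b,c,d] − εP is not block-positive, i.e. there exist vectors ψ, φ ∈ ℂ⁴ with ⟨ψ⊗φ| (W[a,b,c,d] − εP) |ψ⊗φ⟩ < 0. -/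
open Complex Matrix ComplexOrder

/-- The entanglement witness `W[a,b,c,d]` on `ℂ⁴ ⊗ ℂ⁴`, identified with a
`16 × 16` complex matrix in the product basis `|i,j⟩`, indices mod 4. -/
noncomputable def W4 (a b c d : ℝ) :
    Matrix (Fin 4 × Fin 4) (Fin 4 × Fin 4) ℂ := fun p q =>
  if p = q then
    (if p.2 = p.1 then (a : ℂ)
     else if p.2 = p.1 + 1 then (b : ℂ)
     else if p.2 = p.1 + 2 then (c : ℂ)
     else (d : ℂ))
  else if p.1 = p.2 ∧ q.1 = q.2 then -1 else 0

/-- The product vector `ψ ⊗ φ`. -/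
def prodVec {α β : Type*} (ψ : α → ℂ) (φ : β → ℂ) : α × β → ℂ :=
  fun p => ψ p.1 * φ p.2

/-- The pairing `⟨v| X |v⟩`. -/
noncomputable def pairing {n : Type*} [Fintype n] (X : Matrix n n ℂ) (v : n → ℂ) : ℂ :=
  star v ⬝ᵥ X.mulVec v

open Filter Topology
open scoped ComplexConjugate

/-- The value of `W[a,b,c,d]` on a product vector. -/
noncomputable def witnessForm (a b c d : ℝ) (ψ φ : Fin 4 → ℂ) : ℝ :=
  ∑ i, normSq (ψ i) * (a * normSq (φ i) + b * normSq (φ (i + 1)) + c * normSq (φ (i + 2))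
    + d * normSq (φ (i + 3))) + ∑ i, normSq (ψ i * φ i) - normSq (∑ i, ψ i * φ i)

lemma W4_mulVec_prodVec (a b c d : ℝ) (ψ φ : Fin 4 → ℂ) (i j : Fin 4) :
    (W4 a b c d *ᵥ prodVec ψ φ) (i, j) =
      (if j = i then (a : ℂ) else if j = i + 1 then (b : ℂ) else if j = i + 2 then (c : ℂ)
        else (d : ℂ)) * (ψ i * φ j)
      - if i = j then (∑ k, ψ k * φ k) - ψ i * φ i else 0 := by
  simp only [mulVec, dotProduct, Fintype.sum_prod_type, Fin.sum_univ_four, W4, prodVec]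
  fin_cases i <;> fin_cases j <;> simp <;> ring

lemma pairing_W4_prodVec (a b c d : ℝ) (ψ φ : Fin 4 → ℂ) :
    pairing (W4 a b c d) (prodVec ψ φ) = (witnessForm a b c d ψ φ : ℂ) := by
  simp only [pairing, dotProduct, Fintype.sum_prod_type, W4_mulVec_prodVec, witnessForm,
    normSq_mul]
  push_cast
  simp only [normSq_eq_conj_mul_self, Fin.sum_univ_four, prodVec, Pi.star_apply, RCLike.star_def,
    map_mul, map_add]
  simp [Fin.ext_iff]
  ring

lemma witnessForm_comp_add (a b c d : ℝ) (ψ φ : Fin 4 → ℂ) (k : Fin 4) :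
    witnessForm a b c d (fun i => ψ (i + k)) (fun i => φ (i + k)) = witnessForm a b c d ψ φ := by
  simp only [witnessForm, fun i j : Fin 4 => add_right_comm i j k]
  rw [← Equiv.sum_comp (Equiv.addRight k) (fun i => normSq (ψ i) * _),
    ← Equiv.sum_comp (Equiv.addRight k) (fun i => normSq (ψ i * φ i)),
    ← Equiv.sum_comp (Equiv.addRight k) (fun i => ψ i * φ i)]
  rfl

/-- Along `|ψ|² = (s, t, s, t)` the witness vanishes on `ψ ⊗ ψ̄`. -/
lemma witnessForm_conj_eq_zero {a b c d : ℝ} (h1 : a + c = 1) (h2 : b + d = 2) (ψ : Fin 4 → ℂ)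
    (h02 : normSq (ψ 0) = normSq (ψ 2)) (h13 : normSq (ψ 1) = normSq (ψ 3)) :
    witnessForm a b c d ψ (fun i => conj (ψ i)) = 0 := by
  obtain rfl : c = 1 - a := by linarith
  obtain rfl : d = 2 - b := by linarith
  have h : ∀ i, ψ i * conj (ψ i) = ((normSq (ψ i) : ℝ) : ℂ) := fun i => mul_conj _
  simp only [witnessForm, h, ← ofReal_sum, normSq_ofReal, normSq_conj]
  simp [Fin.sum_univ_four, h02, h13]
  ring

lemma pairing_smul {n : Type*} [Fintype n] (P : Matrix n n ℂ) (r : ℝ) (v : n → ℂ) :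
    pairing P ((r : ℂ) • v) = ((r ^ 2 : ℝ) : ℂ) * pairing P v := by
  simp [pairing, mulVec_smul]
  ring

lemma pairing_congr {n : Type*} [Fintype n] {P : Matrix n n ℂ} (hP : P.IsHermitian)
    {v w : n → ℂ} (h : P *ᵥ v = P *ᵥ w) : pairing P v = pairing P w := by
  have key : ∀ x y, star x ⬝ᵥ P *ᵥ y = star (P *ᵥ x) ⬝ᵥ y := fun x y => by
    rw [star_mulVec, hP.eq, dotProduct_mulVec]
  rw [pairing, pairing, h, key, h, key]

lemma mulVec_eq_zero_of_tendsto {n : Type*} [Fintype n] {P : Matrix n n ℂ} (hP : P.PosSemidef)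
    (x y : n → ℂ) {γ g : ℝ → ℝ} (hγ : Tendsto γ (𝓝[>] 0) (𝓝 0)) (hg : Tendsto g (𝓝[>] 0) (𝓝 0))
    (h : ∀ᶠ t in 𝓝[>] 0, (pairing P (x + (γ t : ℂ) • y)).re ≤ g t) : P *ᵥ x = 0 := by
  have hc : Continuous fun r : ℝ => (pairing P (x + (r : ℂ) • y)).re := by
    unfold pairing
    fun_prop
  have hlim := le_of_tendsto_of_tendsto ((hc.tendsto 0).comp hγ) hg h
  have hx : pairing P x = 0 := by
    have := hP.dotProduct_mulVec_nonneg x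
    refine le_antisymm ?_ this
    rw [Complex.le_def] at this ⊢
    exact ⟨by simpa using hlim, this.2.symm⟩
  exact (hP.dotProduct_mulVec_zero_iff x).1 hx

/-- The exponents `0, 1, 3, 9` have pairwise distinct differences modulo `13`. -/
lemma eq_zero_of_forall_phases {g : Fin 4 → Fin 4 → ℂ}
    (h : ∀ z : Fin 4 → ℂ, (∀ i, normSq (z i) = 1) → ∑ i, ∑ j, z i * conj (z j) * g i j = 0)
    {i j : Fin 4} (hij : i ≠ j) : g i j = 0 := by
  obtain ⟨ζ, hζ⟩ : ∃ ζ : ℂ, IsPrimitiveRoot ζ 13 :=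
    ⟨_, Complex.isPrimitiveRoot_exp 13 (by norm_num)⟩
  have hn : normSq ζ = 1 := by
    rw [normSq_eq_norm_sq, hζ.norm'_eq_one (by norm_num), one_pow]
  have hconj : conj ζ = ζ ^ 12 := by
    have h0 : ζ ≠ 0 := hζ.ne_zero (by norm_num)
    apply mul_left_cancel₀ h0
    rw [mul_conj, hn, ← pow_succ', hζ.pow_eq_one, ofReal_one]
  let m : Fin 4 → ℕ := ![0, 1, 3, 9]
  have hsum : ∀ k l, ∑ s ∈ Finset.range 13, (ζ ^ (m k + 12 * m l + 12 * m i + m j)) ^ s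
      = if k = i ∧ l = j then 13 else 0 := fun k l => by
    split_ifs with hkl
    · obtain ⟨rfl, rfl⟩ := hkl
      have : ζ ^ (m k + 12 * m l + 12 * m k + m l) = 1 := by
        rw [hζ.pow_eq_one_iff_dvd]
        exact ⟨m k + m l, by ring⟩
      simp [this]
    · have hnd : ¬ 13 ∣ m k + 12 * m l + 12 * m i + m j := by
        revert i j k l
        decide
      have hne : ζ ^ (m k + 12 * m l + 12 * m i + m j) ≠ 1 := by
        rwa [Ne, hζ.pow_eq_one_iff_dvd]
      rw [geom_sum_eq hne, ← pow_mul, mul_comm _ 13, pow_mul, hζ.pow_eq_one]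
      simp
  have hz : ∀ s : ℕ, ∑ k, ∑ l, (ζ ^ (m k + 12 * m l + 12 * m i + m j)) ^ s * g k l = 0 := by
    intro s
    have := h (fun k => ζ ^ (m k * s)) (fun k => by simp [hn])
    simp only [map_pow, hconj] at this
    rw [← mul_zero (ζ ^ ((12 * m i + m j) * s)), ← this, Finset.mul_sum]
    refine Finset.sum_congr rfl fun k _ => ?_
    rw [Finset.mul_sum]
    refine Finset.sum_congr rfl fun l _ => ?_
    ring
  have htot : ∑ s ∈ Finset.range 13, ∑ k, ∑ l,
      (ζ ^ (m k + 12 * m l + 12 * m i + m j)) ^ s * g k l = 0 :=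
    Finset.sum_eq_zero fun s _ => hz s
  rw [Finset.sum_comm] at htot
  simp_rw [Finset.sum_comm (s := Finset.range 13), ← Finset.sum_mul, hsum, ite_and, ite_mul,
    zero_mul] at htot
  simpa using htot

lemma mulVec_prodVec_apply (P : Matrix (Fin 4 × Fin 4) (Fin 4 × Fin 4) ℂ) (ψ φ : Fin 4 → ℂ)
    (p : Fin 4 × Fin 4) : (P *ᵥ prodVec ψ φ) p = ∑ i, ∑ j, ψ i * φ j * P p (i, j) := by
  simp only [mulVec, dotProduct, Fintype.sum_prod_type, prodVec, mul_comm]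

/-- The left factor of product vectors approaching `|00⟩ + |22⟩` tangentially. -/
noncomputable def tangentLeft (t δ : ℝ) : Fin 4 → ℂ :=
  ![(√(1 - t + δ) : ℝ), (√(2 * t) : ℝ), (√(1 - t - δ) : ℝ), 0]

/-- The right factor minimizing the witness against `tangentLeft t δ`. -/
noncomputable def tangentRight (t δ : ℝ) : Fin 4 → ℂ :=
  ![(√(1 - t + δ) / (1 + δ) : ℝ), (√(2 * t) : ℝ), (√(1 - t - δ) / (1 - δ) : ℝ), 0]

lemma witnessForm_tangent {a b c d r t : ℝ} (h1 : a + c = 1) (h2 : b + d = 2)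
    (h3 : a * c = (1 - b) ^ 2) (hr : a = r * (b - 1)) (hb : b ≠ 1) (ht : 0 < t)
    (hX : 0 < 1 - t - r * t) (hY : 0 < 1 - t + r * t) :
    witnessForm a b c d (tangentLeft t (-(r * t))) (tangentRight t (-(r * t))) =
      (2 * t) ^ 2 * ((1 - t * (r * t) ^ 2 / (1 - (r * t) ^ 2)) * (r ^ 2 * t)
        / (1 - (r * t) ^ 2)) := by
  have hp : 1 + t * r ≠ 0 := by linarith
  have hm : 1 - t * r ≠ 0 := by linarith
  have hr0 : 1 + r ^ 2 ≠ 0 := by positivity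
  have hbr : b = 1 + r / (1 + r ^ 2) := by
    have : r * c = b - 1 := by
      apply mul_right_cancel₀ (sub_ne_zero.2 hb)
      rw [hr] at h3
      linear_combination h3
    field_simp
    linear_combination r * h1 - r * hr - this
  have har : a = r ^ 2 / (1 + r ^ 2) := by rw [hr, hbr]; field_simp; ring
  have hcr : c = 1 / (1 + r ^ 2) := by
    rw [eq_sub_of_add_eq' h1, har]; field_simp; ring
  have hdr : d = 1 - r / (1 + r ^ 2) := by linarith
  have e1 : 1 - t + -(r * t) = 1 - t - r * t := by ring
  have e2 : 1 - t - -(r * t) = 1 - t + r * t := by ring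
  have e3 : 1 + -(r * t) = 1 - r * t := by ring
  have e4 : 1 - -(r * t) = 1 + r * t := by ring
  have q1 := Real.mul_self_sqrt hX.le
  have q2 := Real.mul_self_sqrt hY.le
  have q3 := Real.mul_self_sqrt (by positivity : 0 ≤ 2 * t)
  simp only [witnessForm, tangentLeft, tangentRight, e1, e2, e3, e4]
  generalize √(1 - t - r * t) = x at *
  generalize √(1 - t + r * t) = y at *
  generalize √(2 * t) = z at *
  have hS : ∀ u v w : ℝ, normSq ((u : ℂ) + v + w) = (u + v + w) ^ 2 := fun u v w => by
    rw [← ofReal_add, ← ofReal_add, normSq_ofReal, sq]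
  simp only [Fin.sum_univ_four, Fin.isValue, Fin.reduceAdd, Matrix.cons_val, zero_add, mul_zero,
    map_zero, add_zero, zero_mul, ← ofReal_mul, hS, normSq_ofReal,
    div_mul_eq_mul_div, mul_div_assoc', q1, q2, q3]
  rw [har, hbr, hcr, hdr]
  rw [show 1 - (r * t) ^ 2 = (1 + r * t) * (1 - r * t) by ring]
  field_simp
  ring

lemma tendsto_div_one_sub_sq (r : ℝ) :
    Tendsto (fun t : ℝ => -(r * t) / (1 - (r * t) ^ 2)) (𝓝[>] 0) (𝓝 0) := by
  have : ContinuousAt (fun t : ℝ => -(r * t) / (1 - (r * t) ^ 2)) 0 :=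
    ContinuousAt.div (by fun_prop) (by fun_prop) (by simp)
  simpa using this.tendsto.mono_left nhdsWithin_le_nhds

lemma tendsto_tangent_bound (r ε : ℝ) :
    Tendsto (fun t : ℝ => (1 - t * (r * t) ^ 2 / (1 - (r * t) ^ 2)) * (r ^ 2 * t)
      / (1 - (r * t) ^ 2) / ε) (𝓝[>] 0) (𝓝 0) := by
  have : ContinuousAt (fun t : ℝ => (1 - t * (r * t) ^ 2 / (1 - (r * t) ^ 2)) * (r ^ 2 * t)
      / (1 - (r * t) ^ 2) / ε) 0 := by
    refine ContinuousAt.div_const (ContinuousAt.div (ContinuousAt.mul (ContinuousAt.sub (by fun_prop)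
      (ContinuousAt.div (by fun_prop) (by fun_prop) (by simp))) (by fun_prop)) (by fun_prop)
      (by simp)) _
  simpa using this.tendsto.mono_left nhdsWithin_le_nhds

section Dominated

variable {a b c d ε : ℝ} {P : Matrix (Fin 4 × Fin 4) (Fin 4 × Fin 4) ℂ}

lemma mulVec_eq_zero_of_witnessForm_eq_zero (hP : P.PosSemidef) (hε : 0 < ε)
    (h : ∀ ψ φ, ε * (pairing P (prodVec ψ φ)).re ≤ witnessForm a b c d ψ φ)
    {ψ φ : Fin 4 → ℂ} (h0 : witnessForm a b c d ψ φ = 0) : P *ᵥ prodVec ψ φ = 0 := by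
  refine (hP.dotProduct_mulVec_zero_iff _).1 ?_
  have hnn := hP.dotProduct_mulVec_nonneg (prodVec ψ φ)
  refine le_antisymm ?_ hnn
  rw [Complex.le_def] at hnn ⊢
  have := h ψ φ
  rw [h0] at this
  exact ⟨nonpos_of_mul_nonpos_right this hε, hnn.2.symm⟩

lemma apply_offDiag_eq_zero
    (hP : P.PosSemidef) (hε : 0 < ε) (h1 : a + c = 1) (h2 : b + d = 2)
    (h : ∀ ψ φ, ε * (pairing P (prodVec ψ φ)).re ≤ witnessForm a b c d ψ φ)
    (p : Fin 4 × Fin 4) {i j : Fin 4} (hij : i ≠ j) : P p (i, j) = 0 := by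
  refine eq_zero_of_forall_phases (g := fun i j => P p (i, j)) (fun z hz => ?_) hij
  have := mulVec_eq_zero_of_witnessForm_eq_zero hP hε h
    (witnessForm_conj_eq_zero h1 h2 z (by simp [hz]) (by simp [hz]))
  rw [← mulVec_prodVec_apply, this, Pi.zero_apply]

lemma mulVec_prodVec_apply_eq_diag
    (hP : P.PosSemidef) (hε : 0 < ε) (h1 : a + c = 1) (h2 : b + d = 2)
    (h : ∀ ψ φ, ε * (pairing P (prodVec ψ φ)).re ≤ witnessForm a b c d ψ φ)
    (p : Fin 4 × Fin 4) (ψ φ : Fin 4 → ℂ) :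
    (P *ᵥ prodVec ψ φ) p = ∑ i, ψ i * φ i * P p (i, i) := by
  rw [mulVec_prodVec_apply]
  refine Finset.sum_congr rfl fun i _ => Finset.sum_eq_single i (fun j _ hj => ?_) (by simp)
  rw [apply_offDiag_eq_zero hP hε h1 h2 h p hj.symm, mul_zero]

lemma apply_add_two_eq_neg
    (hP : P.PosSemidef) (hε : 0 < ε) (h1 : a + c = 1) (h2 : b + d = 2)
    (h : ∀ ψ φ, ε * (pairing P (prodVec ψ φ)).re ≤ witnessForm a b c d ψ φ)
    (p : Fin 4 × Fin 4) (i : Fin 4) :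
    P p (i + 2, i + 2) = - P p (i, i) := by
  have key : ∀ ψ : Fin 4 → ℂ, normSq (ψ 0) = normSq (ψ 2) → normSq (ψ 1) = normSq (ψ 3) →
      ∑ i, ψ i * conj (ψ i) * P p (i, i) = 0 := fun ψ h02 h13 => by
    rw [← mulVec_prodVec_apply_eq_diag hP hε h1 h2 h, mulVec_eq_zero_of_witnessForm_eq_zero hP hε h
      (witnessForm_conj_eq_zero h1 h2 ψ h02 h13), Pi.zero_apply]
  have k0 := key ![1, 0, 1, 0] (by simp) (by simp)
  have k1 := key ![0, 1, 0, 1] (by simp) (by simp)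
  simp [Fin.sum_univ_four] at k0 k1
  fin_cases i <;> simp
  · linear_combination k0
  · linear_combination k1
  · linear_combination k0
  · linear_combination k1

lemma apply_diag_eq_zero
    (hP : P.PosSemidef) (hε : 0 < ε) (h1 : a + c = 1) (h2 : b + d = 2)
    (h : ∀ ψ φ, ε * (pairing P (prodVec ψ φ)).re ≤ witnessForm a b c d ψ φ)
    (h3 : a * c = (1 - b) ^ 2) (hb : b ≠ 1) (p : Fin 4 × Fin 4) (k : Fin 4) :
    P p (k + 1, k + 1) = 0 := by
  obtain ⟨r, hr⟩ : ∃ r, a = r * (b - 1) := ⟨a / (b - 1), by field_simp [sub_ne_zero.2 hb]⟩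
  have hX : ∀ᶠ t : ℝ in 𝓝[>] 0, 0 < 1 - t - r * t :=
    nhdsWithin_le_nhds (continuousAt_const.eventually_lt (by fun_prop) (by simp))
  have hY : ∀ᶠ t : ℝ in 𝓝[>] 0, 0 < 1 - t + r * t :=
    nhdsWithin_le_nhds (continuousAt_const.eventually_lt (by fun_prop) (by simp))
  have := mulVec_eq_zero_of_tendsto hP (Pi.single (k + 1, k + 1) 1) (Pi.single (k, k) 1)
    (tendsto_div_one_sub_sq r) (tendsto_tangent_bound r ε) ?_
  · simpa using congrFun this p
  filter_upwards [hX, hY, self_mem_nhdsWithin] with t hX hY ht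
  replace ht : 0 < t := ht
  have hw := h (fun i => tangentLeft t (-(r * t)) (i + -k))
    (fun i => tangentRight t (-(r * t)) (i + -k))
  rw [witnessForm_comp_add, witnessForm_tangent h1 h2 h3 hr hb ht hX hY, pairing_congr
    (w := ((2 * t : ℝ) : ℂ) • (Pi.single (k + 1, k + 1) 1
      + ((-(r * t) / (1 - (r * t) ^ 2) : ℝ) : ℂ) • Pi.single (k, k) 1)) hP.1,
    pairing_smul, re_ofReal_mul] at hw
  · rw [le_div_iff₀ hε]
    refine le_of_mul_le_mul_left ?_ (by positivity : 0 < (2 * t) ^ 2)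
    linarith
  ext q
  rw [mulVec_prodVec_apply_eq_diag hP hε h1 h2 h, ← Equiv.sum_comp (Equiv.addRight k)]
  have e1 := apply_add_two_eq_neg hP hε h1 h2 h q k
  have hp : 1 + t * r ≠ 0 := by linarith
  have hm : 1 - t * r ≠ 0 := by linarith
  have q1 := Real.mul_self_sqrt hX.le
  have q2 := Real.mul_self_sqrt hY.le
  have q3 := Real.mul_self_sqrt (by positivity : 0 ≤ 2 * t)
  have hα : √(1 - t - r * t) * (√(1 - t - r * t) / (1 - r * t))
      - √(1 - t + r * t) * (√(1 - t + r * t) / (1 + r * t))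
      = 2 * t * (-(r * t) / (1 - (r * t) ^ 2)) := by
    rw [mul_div_assoc', mul_div_assoc', q1, q2,
      show 1 - (r * t) ^ 2 = (1 + r * t) * (1 - r * t) by ring]
    field_simp
    ring
  have hα' := congrArg (fun x : ℝ => (x : ℂ)) hα
  have q3' := congrArg (fun x : ℝ => (x : ℂ)) q3
  have f1 : 1 - t + -(r * t) = 1 - t - r * t := by ring
  have f2 : 1 - t - -(r * t) = 1 - t + r * t := by ring
  have f3 : 1 + -(r * t) = 1 - r * t := by ring
  have f4 : 1 - -(r * t) = 1 + r * t := by ring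
  simp only [Equiv.coe_addRight, add_neg_cancel_right, Fin.sum_univ_four, tangentLeft,
    tangentRight, f1, f2, f3, f4, Fin.isValue, Matrix.cons_val, zero_mul, add_zero, zero_add]
  simp only [add_comm _ k, e1, mulVec_smul, mulVec_add, mulVec_single_one, Pi.smul_apply, Pi.add_apply,
    Matrix.col_apply, smul_eq_mul]
  simp only [ofReal_mul, ofReal_sub] at hα' q3' ⊢
  linear_combination P q (k, k) * hα' + P q (k + 1, k + 1) * q3'

end Dominated

lemma pairing_sub_smul_lt_zero {n : Type*} [Fintype n] {X P : Matrix n n ℂ} (hP : P.PosSemidef)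
    {v : n → ℂ} {x ε : ℝ} (hx : pairing X v = (x : ℂ)) (hlt : x < ε * (pairing P v).re) :
    pairing (X - (ε : ℂ) • P) v < 0 := by
  have hnn : 0 ≤ pairing P v := hP.dotProduct_mulVec_nonneg v
  have e : pairing (X - (ε : ℂ) • P) v = pairing X v - ε * pairing P v := by
    simp [pairing, sub_mulVec, smul_mulVec]
  rw [e, hx, Complex.lt_def]
  rw [Complex.le_def] at hnn
  simp [← hnn.2, hlt]

/-- for Class II parameters with `a < 1`, the witness `W[a,b,c,d]` is
optimal: subtracting `ε P` for any nonzero PSD `P` and `ε > 0` destroys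
block-positivity. -/
theorem W4_classII_optimal (a b c d : ℝ)
    (ha : 0 ≤ a) (hb : 0 ≤ b) (hc : 0 ≤ c) (hd : 0 ≤ d)
    (h1 : a + c = 1) (h2 : b + d = 2) (h3 : a * c = (1 - b) ^ 2) (ha1 : a < 1)
    (P : Matrix (Fin 4 × Fin 4) (Fin 4 × Fin 4) ℂ) (hP : P.PosSemidef) (hP0 : P ≠ 0)
    (ε : ℝ) (hε : 0 < ε) :
    ∃ ψ φ : Fin 4 → ℂ, pairing (W4 a b c d - (ε : ℂ) • P) (prodVec ψ φ) < 0 := by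
  by_contra! hcon
  have h : ∀ ψ φ, ε * (pairing P (prodVec ψ φ)).re ≤ witnessForm a b c d ψ φ := fun ψ φ =>
    not_lt.1 fun hlt =>
      hcon ψ φ (pairing_sub_smul_lt_zero hP (pairing_W4_prodVec a b c d ψ φ) hlt)
  refine hP0 ?_
  ext p ⟨i, j⟩
  by_cases hij : i = j
  · subst hij
    by_cases hb1 : b = 1
    · have ha0 : a = 0 := by
        have : a * c = 0 := by rw [h3, hb1]; ring
        rcases mul_eq_zero.1 this with h0 | h0 <;> linarith
      have h0 : witnessForm a b c d (Pi.single i 1) (Pi.single i 1) = 0 := by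
        subst ha0
        fin_cases i <;> simp [witnessForm, Fin.sum_univ_four]
      have := congrFun (mulVec_eq_zero_of_witnessForm_eq_zero hP hε h h0) p
      rw [mulVec_prodVec_apply_eq_diag hP hε h1 h2 h] at this
      simpa [Pi.single_apply] using this
    · simpa using apply_diag_eq_zero hP hε h1 h2 h h3 hb1 p (i - 1)
  · exact apply_offDiag_eq_zero hP hε h1 h2 h p hij
end

section
/- Let W be a Hermitian block-positive operator on ℂⁿ ⊗ ℂᵐ. If the set of product vectors { ψ⊗φ : ψ ∈ ℂⁿ, φ ∈ ℂᵐ, ⟨ψ⊗φ| W |ψ⊗φ⟩ = 0 } spans the whole space ℂⁿ ⊗ ℂᵐ, then for every nonzero positive semidefinite operator P on ℂⁿ ⊗ ℂᵐ and every ε > 0, the operator W − εP is not block-positive (i.e. W is an optimal entanglement witness). -/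
open Complex Matrix ComplexOrder

/-- A positive semidefinite matrix whose pairing vanishes on a spanning set is zero. -/
theorem Matrix.PosSemidef.eq_zero_of_pairing_eq_zero {n : Type*} [Fintype n]
    {P : Matrix n n ℂ} (hP : P.PosSemidef) {S : Set (n → ℂ)}
    (hS : Submodule.span ℂ S = ⊤) (h : ∀ v ∈ S, pairing P v = 0) : P = 0 := by
  have hker : P.mulVecLin = 0 :=
    LinearMap.ext_on hS fun v hv => (hP.dotProduct_mulVec_zero_iff v).1 (h v hv)
  exact Matrix.mulVec_injective <| funext fun v => by
    simpa using LinearMap.congr_fun hker v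

theorem pairing_sub_smul {n : Type*} [Fintype n] (A B : Matrix n n ℂ) (c : ℂ) (v : n → ℂ) :
    pairing (A - c • B) v = pairing A v - c * pairing B v := by
  simp [pairing, Matrix.sub_mulVec, Matrix.smul_mulVec, dotProduct_sub, dotProduct_smul]

/-- spanning criterion of Lewenstein–Kraus–Cirac–Horodecki:
if a Hermitian block-positive `W` on `ℂⁿ ⊗ ℂᵐ` admits a spanning family of
product vectors `ψ ⊗ φ` with `⟨ψ⊗φ|W|ψ⊗φ⟩ = 0`, then for every nonzero PSD `P`
and every `ε > 0`, the operator `W - εP` is not block-positive. -/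
theorem spanning_implies_optimal (n m : ℕ)
    (W : Matrix (Fin n × Fin m) (Fin n × Fin m) ℂ) (hW : W.IsHermitian)
    (hBP : ∀ (ψ : Fin n → ℂ) (φ : Fin m → ℂ), 0 ≤ pairing W (prodVec ψ φ))
    (hspan : Submodule.span ℂ {v : Fin n × Fin m → ℂ |
        ∃ (ψ : Fin n → ℂ) (φ : Fin m → ℂ), v = prodVec ψ φ ∧ pairing W v = 0} = ⊤)
    (P : Matrix (Fin n × Fin m) (Fin n × Fin m) ℂ) (hP : P.PosSemidef) (hP0 : P ≠ 0)
    (ε : ℝ) (hε : 0 < ε) :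
    ∃ (ψ : Fin n → ℂ) (φ : Fin m → ℂ),
      pairing (W - (ε : ℂ) • P) (prodVec ψ φ) < 0 := by
  by_contra! hcon
  refine hP0 (hP.eq_zero_of_pairing_eq_zero hspan ?_)
  rintro v ⟨ψ, φ, rfl, hv⟩
  by_contra hne
  have hpos : 0 < pairing P (prodVec ψ φ) :=
    (hP.dotProduct_mulVec_nonneg _).lt_of_ne' hne
  have hεc : (0 : ℂ) < ε := by exact_mod_cast hε
  refine hcon ψ φ ?_
  rw [pairing_sub_smul, hv, zero_sub, neg_lt_zero]
  exact mul_pos hεc hpos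
end

section
/- Let a,b,c,d ≥ 0 satisfy a+c = 2, b+d = 1, bd = (1-a)² (Class I) with a < 1 (so b > 0), and set t = (1-a)/b. For each i ∈ {1,2,3,4} (indices mod 4), the product vectors ψ⊗φ with (ψ, φ) = (√t|i⟩+|i+1⟩, √t|i⟩+t|i+1⟩) and (ψ, φ) = (√t|i⟩+i·|i+1⟩, √t|i⟩−i·t|i+1⟩) (here i· denotes the imaginary unit) all satisfy ⟨ψ⊗φ| W[a,b,c,d] |ψ⊗φ⟩ = 0. -/
open Complex Matrix ComplexOrder

/-- The value of the quadratic form of `W[a,b,c,d]` on a two-level product vector. -/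
theorem pairing_W4_prodVec_twoLevel (a b c d : ℝ) (s x u y : ℂ) (i : Fin 4) :
    pairing (W4 a b c d)
        (prodVec
          (fun j => if j = i then s else if j = i + 1 then x else 0)
          (fun j => if j = i then u else if j = i + 1 then y else 0)) =
      a * (star (s * u) * (s * u) + star (x * y) * (x * y)) + b * (star (s * y) * (s * y)) +
        d * (star (x * u) * (x * u)) - star (s * u) * (x * y) - star (x * y) * (s * u) := by
  fin_cases i <;>
  · simp [pairing, prodVec, W4, dotProduct, mulVec, Fintype.sum_prod_type, Fin.sum_univ_four]
    ring

/-- for Class I parameters with `a < 1` and `t = (1-a)/b`, the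
two-level product vectors `(√t|i⟩+|i+1⟩) ⊗ (√t|i⟩+t|i+1⟩)` and
`(√t|i⟩+i·|i+1⟩) ⊗ (√t|i⟩-i·t|i+1⟩)` (indices mod 4) annihilate the quadratic
form of `W[a,b,c,d]`. -/
theorem W4_classI_twoLevel_zero (a b c d : ℝ)
    (ha : 0 ≤ a) (hb : 0 ≤ b) (hc : 0 ≤ c) (hd : 0 ≤ d)
    (h1 : a + c = 2) (h2 : b + d = 1) (h3 : b * d = (1 - a) ^ 2) (ha1 : a < 1)
    (t : ℝ) (ht : t = (1 - a) / b) :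
    ∀ i : Fin 4,
      pairing (W4 a b c d)
        (prodVec
          (fun j => if j = i then (Real.sqrt t : ℂ) else if j = i + 1 then 1 else 0)
          (fun j => if j = i then (Real.sqrt t : ℂ) else if j = i + 1 then (t : ℂ) else 0))
        = 0 ∧
      pairing (W4 a b c d)
        (prodVec
          (fun j => if j = i then (Real.sqrt t : ℂ) else if j = i + 1 then Complex.I else 0)
          (fun j => if j = i then (Real.sqrt t : ℂ)
            else if j = i + 1 then -Complex.I * (t : ℂ) else 0))
        = 0 := by
  have hb0 : b ≠ 0 := by
    rintro rfl
    nlinarith [sq_pos_of_pos (sub_pos.mpr ha1)]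
  have hbt : b * t = 1 - a := by rw [ht]; field_simp
  have hdt : d = (1 - a) * t := by
    refine mul_left_cancel₀ hb0 ?_
    linear_combination h3 - (1 - a) * hbt
  have ht0 : 0 ≤ t := ht ▸ div_nonneg (sub_nonneg.mpr ha1.le) hb
  have hs : (Real.sqrt t : ℂ) * Real.sqrt t = t := by
    exact_mod_cast Real.mul_self_sqrt ht0
  have hbt' : (b : ℂ) * t = 1 - a := by exact_mod_cast hbt
  have hdt' : (d : ℂ) = (1 - a) * t := by exact_mod_cast hdt
  have key : ∀ r : ℂ, r * r = t →
      (a : ℂ) * (r * r * (r * r) + t * t) + b * (r * t * (r * t)) + d * (r * r) -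
        r * r * t - t * (r * r) = 0 := by
    intro r hr
    linear_combination (a * (r * r + t) + b * t ^ 2 + d - 2 * t) * hr + t ^ 2 * hbt' + t * hdt'
  intro i
  constructor <;>
    rw [pairing_W4_prodVec_twoLevel, ← key _ hs] <;>
    simp only [star_mul', star_neg, star_one, Complex.star_def, Complex.conj_ofReal, Complex.conj_I]
  · ring
  · ring_nf
    simp only [Complex.I_sq, Complex.I_pow_four]
    ring
end

section
/- Let a,b,c,d ≥ 0 satisfy either a+c = 2, b+d = 1, bd = (1-a)² (Class I) or a+c = 1, b+d = 2, ac = (1-b)² (Class II). Then W[a,b,c,d] is decomposable, i.e. W[a,b,c,d] = P + Q^Γ for some positive semidefinite operators P, Q on ℂ⁴ ⊗ ℂ⁴, if and only if b = d. -/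
open Complex Matrix ComplexOrder

/-- Partial transposition on the second tensor factor:
`⟨i,j| Qᴳ |k,l⟩ = ⟨i,l| Q |k,j⟩`. -/
def ptrans {α β : Type*} (Q : Matrix (α × β) (α × β) ℂ) : Matrix (α × β) (α × β) ℂ :=
  fun p q => Q (p.1, q.2) (q.1, p.2)

/-- A `2 × 2` principal minor of a positive semidefinite matrix, bounding an entry from below. -/
theorem Matrix.PosSemidef.neg_sqrt_le_re {n : Type*} {Q : Matrix n n ℂ}
    (hQ : Q.PosSemidef) (i j : n) :
    -Real.sqrt ((Q i i).re * (Q j j).re) ≤ (Q i j).re := by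
  have hdet := (hQ.submatrix ![i, j]).det_nonneg
  have hji : Q j i = star (Q i j) := (hQ.isHermitian.apply j i).symm
  have hi := (Complex.nonneg_iff.mp (hQ.diag_nonneg (i := i))).2
  have hj := (Complex.nonneg_iff.mp (hQ.diag_nonneg (i := j))).2
  rw [Matrix.det_fin_two] at hdet
  have hre := (Complex.nonneg_iff.mp hdet).1
  simp [hji, Complex.mul_re, ← hi, ← hj] at hre
  refine (abs_le.mp (Real.abs_le_sqrt ?_)).1
  nlinarith [sq_nonneg (Q i j).im]

/-- If a matrix is `P + Qᴳ` with `P, Q` positive semidefinite, then the entry at `(ii, jj)` of `P`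
is bounded in terms of the diagonal of the matrix. -/
theorem re_apply_le_of_eq_add_ptrans {α : Type*}
    {W P Q : Matrix (α × α) (α × α) ℂ} (hP : P.PosSemidef) (hQ : Q.PosSemidef)
    (hW : W = P + ptrans Q) (i j : α) :
    (P (i, i) (j, j)).re ≤ (W (i, i) (j, j)).re +
      Real.sqrt ((W (i, j) (i, j)).re * (W (j, i) (j, i)).re) := by
  have h := hQ.neg_sqrt_le_re (i, j) (j, i)
  have hPd (p : α × α) : 0 ≤ (P p p).re := (Complex.nonneg_iff.mp hP.diag_nonneg).1
  have hQd (p : α × α) : 0 ≤ (Q p p).re := (Complex.nonneg_iff.mp hQ.diag_nonneg).1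
  have hle (p : α × α) : (Q p p).re ≤ (W p p).re := by
    rw [hW]
    simpa [ptrans] using hPd p
  have hs := Real.sqrt_le_sqrt (mul_le_mul (hle (i, j)) (hle (j, i)) (hQd _)
    ((hQd _).trans (hle _)))
  have he : (W (i, i) (j, j)).re = (P (i, i) (j, j)).re + (Q (i, j) (j, i)).re := by
    rw [hW]
    simp [ptrans]
  linarith

theorem W4_eq_of_decomposable {a b c d : ℝ} (hb : 0 ≤ b) (hc : 0 ≤ c) (hd : 0 ≤ d)
    (hsum : a + b + c + d = 3) {P Q : Matrix (Fin 4 × Fin 4) (Fin 4 × Fin 4) ℂ}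
    (hP : P.PosSemidef) (hQ : Q.PosSemidef) (hW : W4 a b c d = P + ptrans Q) : b = d := by
  have hdiag (i : Fin 4) : (P (i, i) (i, i)).re ≤ a := by
    have hQd : 0 ≤ (Q (i, i) (i, i)).re := (Complex.nonneg_iff.mp hQ.diag_nonneg).1
    have he := congrArg Complex.re (congrFun (congrFun hW (i, i)) (i, i))
    simp [W4, ptrans] at he
    linarith
  have hoff := re_apply_le_of_eq_add_ptrans hP hQ hW
  have hsumP : 0 ≤ ∑ i : Fin 4, ∑ j : Fin 4, (P (i, i) (j, j)).re := by
    have h := (hP.submatrix (fun i : Fin 4 => (i, i))).dotProduct_mulVec_nonneg 1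
    simpa [dotProduct, mulVec] using (Complex.nonneg_iff.mp h).1
  have hcc : Real.sqrt (c * c) = c := Real.sqrt_mul_self hc
  have hdb : Real.sqrt (d * b) = Real.sqrt (b * d) := by rw [mul_comm]
  have h01 := hoff 0 1
  have h02 := hoff 0 2
  have h03 := hoff 0 3
  have h10 := hoff 1 0
  have h12 := hoff 1 2
  have h13 := hoff 1 3
  have h20 := hoff 2 0
  have h21 := hoff 2 1
  have h23 := hoff 2 3
  have h30 := hoff 3 0
  have h31 := hoff 3 1
  have h32 := hoff 3 2
  simp [W4, Fin.ext_iff, hcc, hdb] at h01 h02 h03 h10 h12 h13 h20 h21 h23 h30 h31 h32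
  simp only [Fin.sum_univ_four] at hsumP
  have hkey : b + d ≤ 2 * Real.sqrt (b * d) := by
    linarith [hdiag 0, hdiag 1, hdiag 2, hdiag 3]
  have hsq := Real.sq_sqrt (mul_nonneg hb hd)
  nlinarith [sq_nonneg (b - d), Real.sqrt_nonneg (b * d)]

/-- The real multiple `r • v vᴴ` of a rank one projection, as a complex matrix. -/
noncomputable def rankOne {n : Type*} (r : ℝ) (v : n → ℂ) : Matrix n n ℂ :=
  (r : ℂ) • vecMulVec v (star v)

theorem rankOne_posSemidef {n : Type*} [Finite n] {r : ℝ} (hr : 0 ≤ r) (v : n → ℂ) :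
    (rankOne r v).PosSemidef :=
  (posSemidef_vecMulVec_self_star v).smul (by exact_mod_cast hr)

/-- The unnormalized antisymmetric vector `|i,j⟩ - |j,i⟩`. -/
def antisymVec (i j : Fin 4) : Fin 4 × Fin 4 → ℂ :=
  fun p => if p = (i, j) then 1 else if p = (j, i) then -1 else 0

/-- The vector `∑ i, x i |i,i⟩`. -/
def diagVec (x : Fin 4 → ℂ) : Fin 4 × Fin 4 → ℂ :=
  fun p => if p.1 = p.2 then x p.1 else 0

set_option maxHeartbeats 4000000 in
theorem W4_decomposition {a b c : ℝ} (hsum : a + 2 * b + c = 3) :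
    W4 a b c b =
      (rankOne ((a - c + 1) / 2) (diagVec ![1, 0, -1, 0]) +
        rankOne ((a - c + 1) / 2) (diagVec ![0, 1, 0, -1]) +
        rankOne ((a + c + 1 - 2 * b) / 4) (diagVec ![1, -1, 1, -1])) +
      ptrans (rankOne b (antisymVec 0 1) + rankOne b (antisymVec 1 2) +
        rankOne b (antisymVec 2 3) + rankOne b (antisymVec 3 0) +
        rankOne c (antisymVec 0 2) + rankOne c (antisymVec 1 3)) := by
  obtain rfl : c = 3 - a - 2 * b := by linarith
  ext ⟨i, j⟩ ⟨k, l⟩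
  fin_cases i <;> fin_cases j <;> fin_cases k <;> fin_cases l <;>
    simp [W4, ptrans, rankOne, vecMulVec_apply, diagVec, antisymVec, Fin.ext_iff] <;> ring

/-- for Class I or Class II parameters, `W[a,b,c,d]` is decomposable
(i.e. `W = P + Qᴳ` with `P, Q` positive semidefinite) if and only if `b = d`. -/
theorem W4_decomposable_iff (a b c d : ℝ)
    (ha : 0 ≤ a) (hb : 0 ≤ b) (hc : 0 ≤ c) (hd : 0 ≤ d)
    (h : (a + c = 2 ∧ b + d = 1 ∧ b * d = (1 - a) ^ 2) ∨
         (a + c = 1 ∧ b + d = 2 ∧ a * c = (1 - b) ^ 2)) :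
    (∃ P Q : Matrix (Fin 4 × Fin 4) (Fin 4 × Fin 4) ℂ,
        P.PosSemidef ∧ Q.PosSemidef ∧ W4 a b c d = P + ptrans Q) ↔ b = d := by
  constructor
  · rintro ⟨P, Q, hP, hQ, hW⟩
    exact W4_eq_of_decomposable hb hc hd (by rcases h with h | h <;> linarith) hP hQ hW
  · rintro rfl
    have h₁ : 0 ≤ a - c + 1 := by
      rcases h with ⟨h₁, h₂, h₃⟩ | ⟨h₁, h₂, h₃⟩
      · obtain rfl : b = 1 / 2 := by linarith
        nlinarith
      · linarith
    have h₂ : 0 ≤ a + c + 1 - 2 * b := by rcases h with h | h <;> linarith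
    refine ⟨_, _, ?_, ?_, W4_decomposition (by rcases h with h | h <;> linarith)⟩
    · exact ((rankOne_posSemidef (by linarith) _).add (rankOne_posSemidef (by linarith) _)).add
        (rankOne_posSemidef (by linarith) _)
    · exact (((((rankOne_posSemidef hb _).add (rankOne_posSemidef hb _)).add
        (rankOne_posSemidef hb _)).add (rankOne_posSemidef hb _)).add
        (rankOne_posSemidef hc _)).add (rankOne_posSemidef hc _)
end

section
/- For a,b,c ≥ 0, the operator W[a,b,c] on ℂ³ ⊗ ℂ³ is block-positive (⟨ψ⊗φ| W[a,b,c] |ψ⊗φ⟩ ≥ 0 for all ψ, φ ∈ ℂ³) if and only if a+b+c ≥ 2 and (a ≤ 1 implies bc ≥ (1-a)²). -/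
open Complex Matrix ComplexOrder

/-- The operator `W[a,b,c]` on `ℂ³ ⊗ ℂ³`, identified with a `9 × 9` complex
matrix in the product basis `|i,j⟩`, indices mod 3. -/
noncomputable def W3 (a b c : ℝ) :
    Matrix (Fin 3 × Fin 3) (Fin 3 × Fin 3) ℂ := fun p q =>
  if p = q then
    (if p.2 = p.1 then (a : ℂ)
     else if p.2 = p.1 + 1 then (b : ℂ)
     else (c : ℂ))
  else if p.1 = p.2 ∧ q.1 = q.2 then -1 else 0

/-- The block-positivity pairing in terms of absolute values and the overlap `∑ ψᵢ φᵢ`. -/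
lemma pairing_W3_prodVec (a b c : ℝ) (ψ φ : Fin 3 → ℂ) :
    pairing (W3 a b c) (prodVec ψ φ) =
      ((‖ψ 0‖ ^ 2 * ((a + 1) * ‖φ 0‖ ^ 2 + b * ‖φ 1‖ ^ 2 + c * ‖φ 2‖ ^ 2)
        + ‖ψ 1‖ ^ 2 * ((a + 1) * ‖φ 1‖ ^ 2 + b * ‖φ 2‖ ^ 2 + c * ‖φ 0‖ ^ 2)
        + ‖ψ 2‖ ^ 2 * ((a + 1) * ‖φ 2‖ ^ 2 + b * ‖φ 0‖ ^ 2 + c * ‖φ 1‖ ^ 2)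
        - ‖ψ 0 * φ 0 + ψ 1 * φ 1 + ψ 2 * φ 2‖ ^ 2 : ℝ) : ℂ) := by
  push_cast
  simp only [← Complex.conj_mul', map_add, map_mul]
  simp [pairing, dotProduct, mulVec, Fintype.sum_prod_type, Fin.sum_univ_three, W3, prodVec]
  ring

/-- On an edge of the nonnegative orthant, the defect cubic reduces to this quadratic form. -/
lemma edge_quadratic_nonneg {a b c : ℝ} (ha : 0 ≤ a) (hb : 0 ≤ b) (hc : 0 ≤ c)
    (h : a ≤ 1 → (1 - a) ^ 2 ≤ b * c) {u v : ℝ} (hu : 0 ≤ u) (hv : 0 ≤ v) :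
    0 ≤ c * a * u ^ 2 + (a ^ 2 - 1 + b * c) * (u * v) + b * a * v ^ 2 := by
  have huv := mul_nonneg hu hv
  rcases le_total a 1 with h1 | h1
  · have hbc := h h1
    have key : 2 * (1 - a) * (u * v) ≤ c * u ^ 2 + b * v ^ 2 := by
      refine abs_le_of_sq_le_sq' ?_ (by positivity) |>.2
      nlinarith [sq_nonneg (c * u ^ 2 - b * v ^ 2),
        mul_le_mul_of_nonneg_right hbc (sq_nonneg (u * v))]
    nlinarith [mul_le_mul_of_nonneg_left key ha, mul_le_mul_of_nonneg_right hbc huv]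
  · have : 0 ≤ a ^ 2 - 1 + b * c := by nlinarith [mul_nonneg hb hc]
    positivity

/-- The coefficient of `u² - uv + v²` in the expansion of the defect cubic at the diagonal. -/
lemma diagonal_hessian_nonneg {a b c : ℝ} (ha : 0 ≤ a) (hb : 0 ≤ b) (hc : 0 ≤ c)
    (hsum : 2 ≤ a + b + c) (h : a ≤ 1 → (1 - a) ^ 2 ≤ b * c) :
    0 ≤ b * c * a + (b + c) ^ 2 * a + b * c * (b + c) + (b + c) * (a ^ 2 - 1) := by
  have hs : 0 ≤ b + c := add_nonneg hb hc
  have hbc := mul_nonneg hb hc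
  rcases le_total a 1 with h1 | h1
  · have h2 : (1 - a) ^ 2 * (a + (b + c)) ≤ b * c * (a + (b + c)) :=
      mul_le_mul_of_nonneg_right (h h1) (by positivity)
    have h3 : 0 ≤ (b + c) * (a * (a + b + c - 2)) :=
      mul_nonneg hs (mul_nonneg ha (by linarith))
    have h4 : 0 ≤ a * (1 - a) ^ 2 := by positivity
    have h5 : 0 ≤ (b + c) * a ^ 2 := by positivity
    nlinarith
  · have : 0 ≤ a ^ 2 - 1 := by nlinarith
    positivity

lemma defect_cubic_nonneg_of_min {a b c : ℝ} (ha : 0 ≤ a) (hb : 0 ≤ b) (hc : 0 ≤ c)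
    (hsum : 2 ≤ a + b + c) (h : a ≤ 1 → (1 - a) ^ 2 ≤ b * c)
    {x y z : ℝ} (hz : 0 ≤ z) (hx : z ≤ x) (hy : z ≤ y) :
    x * (((a + 1) * y + b * z + c * x) * ((a + 1) * z + b * x + c * y))
      + y * (((a + 1) * x + b * y + c * z) * ((a + 1) * z + b * x + c * y))
      + z * (((a + 1) * x + b * y + c * z) * ((a + 1) * y + b * z + c * x))
    ≤ ((a + 1) * x + b * y + c * z) * ((a + 1) * y + b * z + c * x)
      * ((a + 1) * z + b * x + c * y) := by
  obtain ⟨u, rfl⟩ : ∃ u, x = z + u := ⟨x - z, by ring⟩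
  obtain ⟨v, rfl⟩ : ∃ v, y = z + v := ⟨y - z, by ring⟩
  have hu : 0 ≤ u := by linarith
  have hv : 0 ≤ v := by linarith
  have hdiag : 0 ≤ (a + 1 + b + c) ^ 2 * (a + b + c - 2) *
      (z ^ 3 + z ^ 2 * (u + v) + z * (u * v)) :=
    mul_nonneg (mul_nonneg (sq_nonneg _) (by linarith)) (by positivity)
  have hhess := mul_nonneg (mul_nonneg (diagonal_hessian_nonneg ha hb hc hsum h) hz)
    (show 0 ≤ u ^ 2 - u * v + v ^ 2 by nlinarith [sq_nonneg (u - v), mul_nonneg hu hv])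
  have hedge := mul_nonneg (show 0 ≤ b * u + c * v by positivity)
    (edge_quadratic_nonneg ha hb hc h hu hv)
  linear_combination hdiag + hhess + hedge

/-- With `Dᵢ = (a+1)tᵢ + b tᵢ₊₁ + c tᵢ₊₂`, this is `∑ tᵢ / Dᵢ ≤ 1` cleared of denominators. -/
lemma defect_cubic_nonneg {a b c : ℝ} (ha : 0 ≤ a) (hb : 0 ≤ b) (hc : 0 ≤ c)
    (hsum : 2 ≤ a + b + c) (h : a ≤ 1 → (1 - a) ^ 2 ≤ b * c)
    {x y z : ℝ} (hx : 0 ≤ x) (hy : 0 ≤ y) (hz : 0 ≤ z) :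
    x * (((a + 1) * y + b * z + c * x) * ((a + 1) * z + b * x + c * y))
      + y * (((a + 1) * x + b * y + c * z) * ((a + 1) * z + b * x + c * y))
      + z * (((a + 1) * x + b * y + c * z) * ((a + 1) * y + b * z + c * x))
    ≤ ((a + 1) * x + b * y + c * z) * ((a + 1) * y + b * z + c * x)
      * ((a + 1) * z + b * x + c * y) := by
  by_cases hzmin : z ≤ x ∧ z ≤ y
  · exact defect_cubic_nonneg_of_min ha hb hc hsum h hz hzmin.1 hzmin.2
  by_cases hxmin : x ≤ y ∧ x ≤ z
  · linear_combination defect_cubic_nonneg_of_min ha hb hc hsum h hx hxmin.1 hxmin.2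
  · have hymin : y ≤ z ∧ y ≤ x := by grind
    linear_combination defect_cubic_nonneg_of_min ha hb hc hsum h hy hymin.1 hymin.2

/-- Weighted Cauchy–Schwarz inequality for three terms, without division. -/
lemma sq_overlap_mul_le {D₁ D₂ D₃ : ℝ} (h₁ : 0 ≤ D₁) (h₂ : 0 ≤ D₂) (h₃ : 0 ≤ D₃)
    (p q r x y z : ℝ) :
    (p * x + q * y + r * z) ^ 2 * (D₁ * D₂ * D₃) ≤
      (p ^ 2 * D₁ + q ^ 2 * D₂ + r ^ 2 * D₃) *
        (x ^ 2 * (D₂ * D₃) + y ^ 2 * (D₁ * D₃) + z ^ 2 * (D₁ * D₂)) := by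
  have e₁ := mul_nonneg h₁ (sq_nonneg (q * z * D₂ - r * y * D₃))
  have e₂ := mul_nonneg h₂ (sq_nonneg (p * z * D₁ - r * x * D₃))
  have e₃ := mul_nonneg h₃ (sq_nonneg (p * y * D₁ - q * x * D₂))
  linear_combination e₁ + e₂ + e₃

lemma sq_overlap_le_of_pos {a b c : ℝ} (ha : 0 ≤ a) (hb : 0 ≤ b) (hc : 0 ≤ c)
    (hsum : 2 ≤ a + b + c) (h : a ≤ 1 → (1 - a) ^ 2 ≤ b * c)
    (p q r : ℝ) {x y z : ℝ} (hx : 0 < x) (hy : 0 < y) (hz : 0 < z) :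
    (p * x + q * y + r * z) ^ 2 ≤
      p ^ 2 * ((a + 1) * x ^ 2 + b * y ^ 2 + c * z ^ 2)
      + q ^ 2 * ((a + 1) * y ^ 2 + b * z ^ 2 + c * x ^ 2)
      + r ^ 2 * ((a + 1) * z ^ 2 + b * x ^ 2 + c * y ^ 2) := by
  have hF := defect_cubic_nonneg ha hb hc hsum h (sq_nonneg x) (sq_nonneg y) (sq_nonneg z)
  have h₁ : 0 < (a + 1) * x ^ 2 + b * y ^ 2 + c * z ^ 2 := by positivity
  have h₂ : 0 < (a + 1) * y ^ 2 + b * z ^ 2 + c * x ^ 2 := by positivity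
  have h₃ : 0 < (a + 1) * z ^ 2 + b * x ^ 2 + c * y ^ 2 := by positivity
  refine le_of_mul_le_mul_right ?_ (mul_pos (mul_pos h₁ h₂) h₃)
  exact (sq_overlap_mul_le h₁.le h₂.le h₃.le p q r x y z).trans
    (mul_le_mul_of_nonneg_left hF (by positivity))

lemma sq_overlap_le {a b c : ℝ} (ha : 0 ≤ a) (hb : 0 ≤ b) (hc : 0 ≤ c)
    (hsum : 2 ≤ a + b + c) (h : a ≤ 1 → (1 - a) ^ 2 ≤ b * c)
    (p q r : ℝ) {x y z : ℝ} (hx : 0 ≤ x) (hy : 0 ≤ y) (hz : 0 ≤ z) :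
    (p * x + q * y + r * z) ^ 2 ≤
      p ^ 2 * ((a + 1) * x ^ 2 + b * y ^ 2 + c * z ^ 2)
      + q ^ 2 * ((a + 1) * y ^ 2 + b * z ^ 2 + c * x ^ 2)
      + r ^ 2 * ((a + 1) * z ^ 2 + b * x ^ 2 + c * y ^ 2) := by
  let f : ℝ → ℝ := fun ε => (p * (x + ε) + q * (y + ε) + r * (z + ε)) ^ 2
  let g : ℝ → ℝ := fun ε =>
    p ^ 2 * ((a + 1) * (x + ε) ^ 2 + b * (y + ε) ^ 2 + c * (z + ε) ^ 2)
      + q ^ 2 * ((a + 1) * (y + ε) ^ 2 + b * (z + ε) ^ 2 + c * (x + ε) ^ 2)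
      + r ^ 2 * ((a + 1) * (z + ε) ^ 2 + b * (x + ε) ^ 2 + c * (y + ε) ^ 2)
  have hf : Continuous f := by fun_prop
  have hg : Continuous g := by fun_prop
  have hfg : f 0 ≤ g 0 := ContinuousWithinAt.closure_le (s := Set.Ioi 0) (by simp)
    hf.continuousWithinAt hg.continuousWithinAt fun ε (hε : 0 < ε) =>
      sq_overlap_le_of_pos ha hb hc hsum h p q r (by positivity) (by positivity) (by positivity)
  simpa [f, g] using hfg

/-- `W[a,b,c]` is block-positive if and only if `a+b+c ≥ 2` and
(`a ≤ 1` implies `bc ≥ (1-a)²`). -/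
theorem W3_blockPositive_iff (a b c : ℝ) (ha : 0 ≤ a) (hb : 0 ≤ b) (hc : 0 ≤ c) :
    (∀ ψ φ : Fin 3 → ℂ, 0 ≤ pairing (W3 a b c) (prodVec ψ φ)) ↔
      (2 ≤ a + b + c ∧ (a ≤ 1 → (1 - a) ^ 2 ≤ b * c)) := by
  simp only [pairing_W3_prodVec, Complex.zero_le_real]
  constructor
  · intro H
    have hedge : ∀ P Q : ℝ, 0 ≤ P → 0 ≤ Q →
        2 * (1 - a) * (P * Q) ≤ b * P ^ 2 + c * Q ^ 2 := by
      intro P Q hP hQ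
      have hPQ := H ![(√P : ℂ), (√Q : ℂ), 0] ![(√Q : ℂ), (√P : ℂ), 0]
      have hnorm : ‖(√P : ℂ) * √Q + √Q * √P‖ ^ 2 = 4 * (P * Q) := by
        rw [← Complex.ofReal_mul, ← Complex.ofReal_mul, ← Complex.ofReal_add,
          Complex.norm_real, Real.norm_eq_abs, sq_abs, mul_comm √Q, ← two_mul, mul_pow, mul_pow,
          Real.sq_sqrt hP, Real.sq_sqrt hQ]
        ring
      simp [hnorm, Real.sq_sqrt hP, Real.sq_sqrt hQ] at hPQ
      linarith
    refine ⟨?_, fun h1 => ?_⟩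
    · have hone := H 1 1
      norm_num at hone
      linarith
    · rcases hb.eq_or_lt with rfl | hb'
      · rcases hc.eq_or_lt with rfl | hc'
        · have := hedge 1 1 zero_le_one zero_le_one
          nlinarith
        · have := hedge c (1 - a) hc (by linarith)
          nlinarith
      · have := hedge (1 - a) b (by linarith) hb
        nlinarith
  · rintro ⟨hsum, h⟩ ψ φ
    have htri : ‖ψ 0 * φ 0 + ψ 1 * φ 1 + ψ 2 * φ 2‖ ≤
        ‖ψ 0‖ * ‖φ 0‖ + ‖ψ 1‖ * ‖φ 1‖ + ‖ψ 2‖ * ‖φ 2‖ := by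
      simpa only [norm_mul] using norm_add₃_le (a := ψ 0 * φ 0) (b := ψ 1 * φ 1) (c := ψ 2 * φ 2)
    exact sub_nonneg.2 <| (pow_le_pow_left₀ (norm_nonneg _) htri 2).trans <|
      sq_overlap_le ha hb hc hsum h _ _ _ (norm_nonneg _) (norm_nonneg _) (norm_nonneg _)
end

section
/- For α ∈ [1,3) ∪ (7,9], the generalized Horodecki state ρ^(4)_α = (1/16)(3 P⁺₄ + α Π₁ + 3 Π₂ + (10−α) Π₃) on ℂ⁴ ⊗ ℂ⁴ has positive semidefinite partial transpose (it is PPT), and there exist a,b,c,d ≥ 0 satisfying either a+c = 2, b+d = 1, bd = (1−a)² (Class I) or a+c = 1, b+d = 2, ac = (1−b)² (Class II) such that Tr(ρ^(4)_α W[a,b,c,d]) < 0; in particular ρ^(4)_α is PPT entangled and its entanglement is detected by the witnesses W[a,b,c,d]. -/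
open Complex Matrix ComplexOrder

/-- `P⁺₄ = (1/4) Σ_{i,j} |i,i⟩⟨j,j|` on `ℂ⁴ ⊗ ℂ⁴`. -/
noncomputable def P4plus : Matrix (Fin 4 × Fin 4) (Fin 4 × Fin 4) ℂ := fun p q =>
  if p.1 = p.2 ∧ q.1 = q.2 then (1 / 4 : ℂ) else 0

/-- `Π_k = (1/4) Σ_l |l,l+k⟩⟨l,l+k|` on `ℂ⁴ ⊗ ℂ⁴`, index mod 4. -/
noncomputable def Pi4 (k : Fin 4) : Matrix (Fin 4 × Fin 4) (Fin 4 × Fin 4) ℂ := fun p q =>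
  if p = q ∧ p.2 = p.1 + k then (1 / 4 : ℂ) else 0

/-- The generalized Horodecki state
`ρ⁽⁴⁾_α = (1/16)(3P⁺₄ + αΠ₁ + 3Π₂ + (10-α)Π₃)`. -/
noncomputable def rho4 (α : ℝ) : Matrix (Fin 4 × Fin 4) (Fin 4 × Fin 4) ℂ :=
  (16 : ℂ)⁻¹ • ((3 : ℂ) • P4plus + (α : ℂ) • Pi4 1 + (3 : ℂ) • Pi4 2 +
    ((10 : ℂ) - (α : ℂ)) • Pi4 3)

lemma quadratic_form_nonneg {a b c : ℝ} (ha : 0 ≤ a) (hb : 0 ≤ b) (hc : c ^ 2 ≤ a * b)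
    (x y : ℝ) : 0 ≤ a * x ^ 2 + 2 * c * (x * y) + b * y ^ 2 := by
  rcases ha.eq_or_lt with rfl | ha
  · obtain rfl : c = 0 := by nlinarith
    nlinarith [mul_nonneg hb (sq_nonneg y)]
  · refine nonneg_of_mul_nonneg_right (a := a) ?_ ha
    nlinarith [sq_nonneg (a * x + c * y), mul_nonneg (sub_nonneg.2 hc) (sq_nonneg y)]

lemma hermitian_form_nonneg {a b c : ℝ} (ha : 0 ≤ a) (hb : 0 ≤ b) (hc : c ^ 2 ≤ a * b)
    (x y : ℂ) :
    0 ≤ star x * (a * x + c * y) + star y * (b * y + c * x) := by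
  rw [Complex.nonneg_iff]
  constructor
  · have h₁ := quadratic_form_nonneg ha hb hc x.re y.re
    have h₂ := quadratic_form_nonneg ha hb hc x.im y.im
    simp
    linarith
  · simp
    ring

/-- A matrix supported on the diagonal and on the graph of an involution `σ` is positive
semidefinite as soon as its `2 × 2` blocks are. -/
lemma posSemidef_of_involutive {n : Type*} [Fintype n] [DecidableEq n] {σ : Equiv.Perm n}
    (hσ : Function.Involutive σ) {w c : n → ℝ} (hw : ∀ p, 0 ≤ w p)
    (hcσ : ∀ p, c (σ p) = c p) (hc : ∀ p, c p ^ 2 ≤ w p * w (σ p)) :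
    (Matrix.of fun p q : n => (if q = p then (w p : ℂ) else 0) +
      if q = σ p then (c p : ℂ) else 0).PosSemidef := by
  refine Matrix.PosSemidef.of_dotProduct_mulVec_nonneg ?_ fun x => ?_
  · ext p q
    have h : p = σ q ↔ q = σ p := ⟨fun h => by rw [h, hσ], fun h => by rw [h, hσ]⟩
    simp only [conjTranspose_apply, of_apply, h, eq_comm (a := p) (b := q)]
    by_cases h₁ : q = p
    · subst h₁
      split_ifs <;> simp
    by_cases h₂ : q = σ p
    · subst h₂
      simp [h₁, hcσ]
    · simp [h₁, h₂]
  · set f : n → ℂ := fun p => star (x p) * (w p * x p + c p * x (σ p))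
    have hf : star x ⬝ᵥ (Matrix.of fun p q : n => (if q = p then (w p : ℂ) else 0) +
        if q = σ p then (c p : ℂ) else 0) *ᵥ x = ∑ p, f p := by
      simp [f, dotProduct, mulVec, add_mul, Finset.sum_add_distrib]
    have hsum : ∑ p, f p = (1 / 2 : ℂ) * ∑ p, (f p + f (σ p)) := by
      rw [Finset.sum_add_distrib, Equiv.sum_comp σ f]
      ring
    rw [hf, hsum]
    refine mul_nonneg (by norm_num [Complex.nonneg_iff]) (Finset.sum_nonneg fun p _ => ?_)
    simpa only [f, hσ p, hcσ p] using hermitian_form_nonneg (hw p) (hw (σ p)) (hc p) (x p) (x (σ p))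

/-- The unnormalized maximally entangled vector `∑ i, |i,i⟩`. -/
def maxEntVec : Fin 4 × Fin 4 → ℂ := fun p => if p.1 = p.2 then 1 else 0

lemma rho4_eq (α : ℝ) :
    rho4 α = (1 / 64 : ℂ) • ((3 : ℂ) • vecMulVec maxEntVec maxEntVec +
      diagonal fun p => (![0, α, 3, 10 - α] (p.2 - p.1) : ℂ)) := by
  ext p q
  by_cases h : p = q
  · subst h
    obtain ⟨i, j⟩ := p
    fin_cases i <;> fin_cases j <;>
      simp [rho4, P4plus, Pi4, vecMulVec_apply, maxEntVec] <;> ring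
  · by_cases h₁ : p.1 = p.2 <;> by_cases h₂ : q.1 = q.2 <;>
      simp [rho4, P4plus, Pi4, vecMulVec_apply, maxEntVec, h, h₁, h₂]
    norm_num

lemma W4_eq (a b c d : ℝ) :
    W4 a b c d = (diagonal fun p => (![a + 1, b, c, d] (p.2 - p.1) : ℂ)) -
      vecMulVec maxEntVec maxEntVec := by
  ext p q
  by_cases h : p = q
  · subst h
    obtain ⟨i, j⟩ := p
    fin_cases i <;> fin_cases j <;> simp [W4, vecMulVec_apply, maxEntVec]
  · by_cases h₁ : p.1 = p.2 <;> by_cases h₂ : q.1 = q.2 <;>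
      simp [W4, vecMulVec_apply, maxEntVec, h, h₁, h₂]

lemma ptrans_rho4_posSemidef {α : ℝ} (h₁ : 1 ≤ α) (h₉ : α ≤ 9) :
    (ptrans (rho4 α)).PosSemidef := by
  set w : Fin 4 × Fin 4 → ℝ := fun p => ![3, α, 3, 10 - α] (p.2 - p.1) / 64
  set c : Fin 4 × Fin 4 → ℝ := fun p => if p.1 = p.2 then 0 else 3 / 64
  convert posSemidef_of_involutive (σ := Equiv.prodComm (Fin 4) (Fin 4)) (w := w) (c := c)
    (fun p => rfl) ?_ ?_ ?_
  · ext ⟨i, j⟩ ⟨k, l⟩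
    have hoff (x y : Fin 4) (hxy : x ≠ y) :
        ![0, α, 3, 10 - α] (y - x) = ![3, α, 3, 10 - α] (y - x) := by
      fin_cases x <;> fin_cases y <;> simp_all
    by_cases hk : k = i <;> by_cases hl : l = j <;> by_cases hij : i = j <;>
      by_cases hil : i = l <;> by_cases hkj : k = j <;>
      simp_all [ptrans, rho4_eq, vecMulVec_apply, diagonal_apply, maxEntVec, w, c,
        eq_comm, div_eq_inv_mul]
  · rintro ⟨i, j⟩
    fin_cases i <;> fin_cases j <;> simp [w] <;> linarith
  · rintro ⟨i, j⟩
    simp [c, eq_comm]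
  · rintro ⟨i, j⟩
    fin_cases i <;> fin_cases j <;> simp [w, c] <;> nlinarith

lemma trace_rho4_mul_W4 (α a b c d : ℝ) :
    (rho4 α * W4 a b c d).trace =
      (((3 * a - 9 + α * b + 3 * c + (10 - α) * d) / 16 : ℝ) : ℂ) := by
  rw [rho4_eq, W4_eq]
  simp only [smul_mul_assoc, trace_smul, add_mul, mul_sub, trace_add, trace_sub,
    diagonal_mul_diagonal, trace_diagonal,
    vecMulVec_mul, mul_vecMulVec, trace_vecMulVec, dotProduct, vecMul_diagonal, mulVec_diagonal,
    Fintype.sum_prod_type, Fin.sum_univ_four]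
  simp [maxEntVec, mulVec, vecMulVec_apply, dotProduct, Fintype.sum_prod_type]
  ring

/-- for `α ∈ [1,3) ∪ (7,9]` the generalized Horodecki state `ρ⁽⁴⁾_α`
is PPT and its entanglement is detected by some witness `W[a,b,c,d]` of Class I
or Class II. -/
theorem rho4_PPT_entangled (α : ℝ)
    (hα : α ∈ Set.Ico (1 : ℝ) 3 ∪ Set.Ioc (7 : ℝ) 9) :
    (ptrans (rho4 α)).PosSemidef ∧
      ∃ a b c d : ℝ, 0 ≤ a ∧ 0 ≤ b ∧ 0 ≤ c ∧ 0 ≤ d ∧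
        ((a + c = 2 ∧ b + d = 1 ∧ b * d = (1 - a) ^ 2) ∨
         (a + c = 1 ∧ b + d = 2 ∧ a * c = (1 - b) ^ 2)) ∧
        (rho4 α * W4 a b c d).trace < 0 := by
  rw [Set.mem_union, Set.mem_Ico, Set.mem_Ioc] at hα
  refine ⟨ptrans_rho4_posSemidef ?_ ?_, ?_⟩
  · rcases hα with h | h <;> linarith
  · rcases hα with h | h <;> linarith
  · simp_rw [trace_rho4_mul_W4, ← Complex.ofReal_zero, Complex.real_lt_real]
    rcases hα with h | h
    · refine ⟨1, 1, 1, 0, ?_, ?_, ?_, ?_, Or.inl ⟨?_, ?_, ?_⟩, ?_⟩ <;> linarith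
    · refine ⟨1, 0, 1, 1, ?_, ?_, ?_, ?_, Or.inl ⟨?_, ?_, ?_⟩, ?_⟩ <;> linarith
end

section
/- The complex linear span of the set of vectors { ψ ⊗ ψ* : ψ = Σ_{k=1}^{4} e^{iλ_k} |k⟩, λ₁,λ₂,λ₃,λ₄ ∈ ℝ } in ℂ⁴ ⊗ ℂ⁴ has dimension 13, while the complex linear span of { ψ ⊗ ψ : ψ = Σ_{k=1}^{4} e^{iλ_k} |k⟩, λ₁,λ₂,λ₃,λ₄ ∈ ℝ } has dimension 10. -/
open Complex Matrix

/-- The character `λ ↦ exp (i ∑ₖ nₖ λₖ)` of `ℝ^ι` with integer frequencies `n`. -/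
noncomputable def phaseChar {ι : Type*} [Fintype ι] (n : ι → ℤ) :
    Multiplicative (ι → ℝ) →* ℂ where
  toFun lam := Complex.exp (Complex.I * ∑ k, (n k : ℂ) * (lam.toAdd k : ℂ))
  map_one' := by simp
  map_mul' x y := by
    rw [← Complex.exp_add, ← mul_add, ← Finset.sum_add_distrib]
    simp [mul_add]

theorem phaseChar_apply {ι : Type*} [Fintype ι] (n : ι → ℤ) (lam : Multiplicative (ι → ℝ)) :
    phaseChar n lam = Complex.exp (Complex.I * ∑ k, (n k : ℂ) * (lam.toAdd k : ℂ)) :=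
  rfl

theorem phaseChar_injective {ι : Type*} [Fintype ι] :
    Function.Injective (phaseChar (ι := ι)) := by
  classical
  intro n m h
  by_contra hne
  obtain ⟨k, hk⟩ := Function.ne_iff.mp hne
  have hd : (n k : ℂ) - (m k : ℂ) ≠ 0 := sub_ne_zero.mpr (by exact_mod_cast hk)
  have key := DFunLike.congr_fun h
    (Multiplicative.ofAdd (Pi.single k (Real.pi / ((n k : ℝ) - (m k : ℝ)))))
  have hsum (a : ι → ℤ) :
      ∑ j, (a j : ℂ) * ((Pi.single k (Real.pi / ((n k : ℝ) - (m k : ℝ))) : ι → ℝ) j : ℂ) =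
        a k * (Real.pi / ((n k : ℂ) - (m k : ℂ))) := by
    rw [Finset.sum_eq_single k (fun j _ hj => by simp [hj]) (by simp)]
    simp
  rw [phaseChar_apply, phaseChar_apply, toAdd_ofAdd, hsum, hsum] at key
  have hexp : Complex.exp (Real.pi * Complex.I) = 1 := by
    rw [show (Real.pi : ℂ) * Complex.I =
        Complex.I * (n k * (Real.pi / ((n k : ℂ) - (m k : ℂ)))) -
          Complex.I * (m k * (Real.pi / ((n k : ℂ) - (m k : ℂ)))) by field_simp,
      Complex.exp_sub, key, div_self (Complex.exp_ne_zero _)]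
  rw [Complex.exp_pi_mul_I] at hexp
  norm_num at hexp

/-- If `c` is surjective and `χ` is a finite linearly independent family of functions, the
vectors of values of `χ ∘ c` span a space whose dimension is the size of the family. -/
theorem finrank_span_range_comp {K G β γ : Type*} [Field K] [Finite β] [Fintype γ]
    {χ : γ → G → K} (hχ : LinearIndependent K χ) {c : β → γ} (hc : Function.Surjective c) :
    Module.finrank K (Submodule.span K (Set.range fun (g : G) (p : β) => χ (c p) g)) =
      Fintype.card γ := by
  have hrange : (Set.range fun (g : G) (p : β) => χ (c p) g) =
      LinearMap.funLeft K K c '' Set.range (flip χ) := by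
    rw [← Set.range_comp]
    rfl
  rw [hrange, Submodule.span_image, span_flip_eq_top_iff_linearIndependent.mpr hχ,
    Submodule.map_top,
    LinearMap.finrank_range_of_inj (LinearMap.funLeft_injective_of_surjective K K c hc),
    Module.finrank_fintype_fun_eq_card]

/-- The vectors of values of a finite family of characters span a space whose dimension is
the number of distinct frequencies in the family. -/
theorem finrank_span_phaseChar {ι β : Type*} [Fintype ι] [Fintype β] [DecidableEq (ι → ℤ)]
    (n : β → ι → ℤ) :
    Module.finrank ℂ (Submodule.span ℂ
      (Set.range fun (lam : Multiplicative (ι → ℝ)) (p : β) => phaseChar (n p) lam)) =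
      (Finset.univ.image n).card := by
  have hli : LinearIndependent ℂ fun x : Finset.univ.image n =>
      (phaseChar x.1 : Multiplicative (ι → ℝ) → ℂ) :=
    LinearIndependent.comp (R := ℂ) (M := Multiplicative (ι → ℝ) → ℂ)
      (linearIndependent_monoidHom (Multiplicative (ι → ℝ)) ℂ)
      (fun x : Finset.univ.image n => phaseChar x.1)
      (phaseChar_injective.comp Subtype.val_injective)
  have hc : Function.Surjective fun p =>
      (⟨n p, Finset.mem_image_of_mem n (Finset.mem_univ p)⟩ : Finset.univ.image n) := by
    rintro ⟨x, hx⟩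
    obtain ⟨p, -, rfl⟩ := Finset.mem_image.mp hx
    exact ⟨p, rfl⟩
  exact (finrank_span_range_comp hli hc).trans (Fintype.card_coe _)

/-- the vectors `ψ ⊗ ψ*` with `ψ = Σ_k e^{iλ_k}|k⟩` span a
13-dimensional subspace of `ℂ⁴ ⊗ ℂ⁴`, while the vectors `ψ ⊗ ψ` span only a
10-dimensional subspace. -/
theorem phase_span_dims :
    Module.finrank ℂ (Submodule.span ℂ {v : Fin 4 × Fin 4 → ℂ |
        ∃ lam : Fin 4 → ℝ, v = prodVec (fun k => Complex.exp (Complex.I * lam k))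
          (fun k => Complex.exp (-(Complex.I * lam k)))}) = 13 ∧
    Module.finrank ℂ (Submodule.span ℂ {v : Fin 4 × Fin 4 → ℂ |
        ∃ lam : Fin 4 → ℝ, v = prodVec (fun k => Complex.exp (Complex.I * lam k))
          (fun k => Complex.exp (Complex.I * lam k))}) = 10 := by
  constructor
  · rw [show (13 : ℕ) = (Finset.univ.image fun p : Fin 4 × Fin 4 =>
        (Pi.single p.1 1 - Pi.single p.2 1 : Fin 4 → ℤ)).card by decide,
      ← finrank_span_phaseChar]
    refine congrArg (fun S : Set (Fin 4 × Fin 4 → ℂ) => Module.finrank ℂ (Submodule.span ℂ S))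
      (Set.ext fun v => exists_congr fun lam => eq_comm.trans (Eq.congr_left ?_))
    funext p
    refine Eq.trans ?_ (phaseChar_apply _ (Multiplicative.ofAdd lam)).symm
    simp [prodVec, ← Complex.exp_add, Pi.single_apply, mul_add,
      Finset.sum_add_distrib, sub_eq_add_neg, add_mul]
  · rw [show (10 : ℕ) = (Finset.univ.image fun p : Fin 4 × Fin 4 =>
        (Pi.single p.1 1 + Pi.single p.2 1 : Fin 4 → ℤ)).card by decide,
      ← finrank_span_phaseChar]
    refine congrArg (fun S : Set (Fin 4 × Fin 4 → ℂ) => Module.finrank ℂ (Submodule.span ℂ S))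
      (Set.ext fun v => exists_congr fun lam => eq_comm.trans (Eq.congr_left ?_))
    funext p
    refine Eq.trans ?_ (phaseChar_apply _ (Multiplicative.ofAdd lam)).symm
    simp [prodVec, ← Complex.exp_add, add_mul, Pi.single_apply, mul_add,
      Finset.sum_add_distrib]
end
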